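/- arXiv:1808.01902 — 3 statements merged into one kernel-verified Lean document; each statement's English description precedes it below -/
import Mathlib

section
/- For every real q with 0 < q < 1, setting x = θ₂(q)²/θ₃(q)², one has M(1 + x, 1 − x) = 1/θ₃(q)², where M is the arithmetic–geometric mean and θ₂, θ₃ are Jacobi theta functions. -/
open Filter Topology

/-- The pair of sequences defined by iterating the arithmetic mean and the geometric mean. -/
noncomputable def agmSeq (a b : ℝ) : ℕ → ℝ × ℝ
  | 0 => (a, b)
  | n + 1 => (((agmSeq a b n).1 + (agmSeq a b n).2) / 2,
      Real.sqrt ((agmSeq a b n).1 * (agmSeq a b n).2))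

/-- The arithmetic–geometric mean of `a` and `b`: the common limit of the two sequences. -/
noncomputable def agm (a b : ℝ) : ℝ :=
  limUnder atTop (fun n => (agmSeq a b n).1)

/-- Real-valued Jacobi theta function `θ₂(q) = 2 ∑_{n ≥ 0} q^{(n+1/2)²}` for real `q > 0`. -/
noncomputable def theta2Real (q : ℝ) : ℝ := 2 * ∑' n : ℕ, q ^ (((n : ℝ) + 1 / 2) ^ 2)

/-- Real-valued Jacobi theta function `θ₃` for real `q`. -/
noncomputable def theta3Real (q : ℝ) : ℝ := ∑' n : ℤ, q ^ (n ^ 2)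

/-- Real-valued Jacobi theta function `θ₄` for real `q`. -/
noncomputable def theta4Real (q : ℝ) : ℝ := ∑' n : ℤ, (-1) ^ n * q ^ (n ^ 2)

/-- A double sum over `ℤ × ℤ` splits according to the parity of the sum of the coordinates. -/
theorem tsum_int_prod_eq_add_of_parity {F : ℤ × ℤ → ℝ} (hF : Summable F) :
    ∑' z, F z = ∑' z : ℤ × ℤ, F (z.1 + z.2, z.1 - z.2) +
      ∑' z : ℤ × ℤ, F (z.1 + z.2 + 1, z.1 - z.2) := by
  have hi : Function.Injective (fun z : ℤ × ℤ => (z.1 + z.2, z.1 - z.2)) := by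
    rintro ⟨a, b⟩ ⟨c, d⟩ h
    simp only [Prod.mk.injEq] at h ⊢
    omega
  have hj : Function.Injective (fun z : ℤ × ℤ => (z.1 + z.2 + 1, z.1 - z.2)) := by
    rintro ⟨a, b⟩ ⟨c, d⟩ h
    simp only [Prod.mk.injEq] at h ⊢
    omega
  have hc : IsCompl (Set.range fun z : ℤ × ℤ => (z.1 + z.2, z.1 - z.2))
      (Set.range fun z : ℤ × ℤ => (z.1 + z.2 + 1, z.1 - z.2)) := by
    rw [isCompl_iff, Set.disjoint_iff_forall_ne, codisjoint_iff_le_sup]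
    constructor
    · rintro _ ⟨⟨a, b⟩, rfl⟩ _ ⟨⟨c, d⟩, rfl⟩ h
      simp only [Prod.mk.injEq] at h
      omega
    · rintro ⟨m, n⟩ -
      rcases Int.even_or_odd' (m + n) with ⟨k, hk | hk⟩
      · exact Or.inl ⟨(k, m - k), by ext <;> simp; omega⟩
      · exact Or.inr ⟨(k, m - k - 1), by ext <;> simp <;> omega⟩
  have h1 : HasSum (F ∘ ((↑) : (Set.range fun z : ℤ × ℤ => (z.1 + z.2, z.1 - z.2)) → ℤ × ℤ)) _ :=
    (hi.hasSum_range_iff (f := F)).2 (hF.comp_injective hi).hasSum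
  have h2 : HasSum (F ∘ ((↑) : (Set.range fun z : ℤ × ℤ =>
      (z.1 + z.2 + 1, z.1 - z.2)) → ℤ × ℤ)) _ :=
    (hj.hasSum_range_iff (f := F)).2 (hF.comp_injective hj).hasSum
  exact (h1.add_isCompl hc h2).tsum_eq

section

variable {q : ℝ}

theorem summable_zpow_sq (hq0 : 0 < q) (hq1 : q < 1) : Summable fun n : ℤ => q ^ (n ^ 2) := by
  have h : Summable fun n : ℕ => q ^ (n ^ 2) :=
    (summable_geometric_of_lt_one hq0.le hq1).of_nonneg_of_le (fun n => by positivity)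
      fun n => pow_le_pow_of_le_one hq0.le hq1.le (Nat.le_self_pow two_ne_zero n)
  refine .of_nat_of_neg (h.congr fun n => ?_) (h.congr fun n => ?_)
  · exact_mod_cast rfl
  · rw [neg_sq]
    exact_mod_cast rfl

theorem summable_neg_one_zpow_mul_zpow_sq (hq0 : 0 < q) (hq1 : q < 1) :
    Summable fun n : ℤ => (-1) ^ n * q ^ (n ^ 2) :=
  .of_norm <| (summable_zpow_sq hq0 hq1).congr fun n => by
    simp [abs_of_pos hq0]

theorem summable_pow_mul_succ (hq0 : 0 < q) (hq1 : q < 1) :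
    Summable fun n : ℕ => q ^ (n * (n + 1)) :=
  (summable_geometric_of_lt_one hq0.le hq1).of_nonneg_of_le (fun n => by positivity)
    fun n => pow_le_pow_of_le_one hq0.le hq1.le (Nat.le_mul_of_pos_right n n.succ_pos)

theorem summable_zpow_mul_succ (hq0 : 0 < q) (hq1 : q < 1) :
    Summable fun n : ℤ => q ^ (n * (n + 1)) := by
  have h := summable_pow_mul_succ hq0 hq1
  refine .of_nat_of_neg_add_one (h.congr fun n => ?_) (h.congr fun n => ?_)
  · exact_mod_cast rfl
  · rw [show (-((n : ℤ) + 1)) * (-((n : ℤ) + 1) + 1) = ((n * (n + 1) : ℕ) : ℤ) by push_cast; ring,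
      zpow_natCast]

theorem summable_neg_one_zpow_mul_zpow_mul_succ (hq0 : 0 < q) (hq1 : q < 1) :
    Summable fun n : ℤ => (-1) ^ n * q ^ (n * (n + 1)) :=
  .of_norm <| (summable_zpow_mul_succ hq0 hq1).congr fun n => by
    simp [abs_of_pos hq0]

theorem tsum_neg_one_zpow_mul_zpow_mul_succ :
    ∑' n : ℤ, (-1) ^ n * q ^ (n * (n + 1)) = 0 := by
  have h := (Equiv.subLeft (-1 : ℤ)).tsum_eq fun n : ℤ => (-1) ^ n * q ^ (n * (n + 1))
  have h' : ∀ n : ℤ, (-1 : ℝ) ^ (-1 - n) * q ^ ((-1 - n) * (-1 - n + 1)) =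
      -((-1) ^ n * q ^ (n * (n + 1))) := fun n => by
    rw [zpow_sub₀ (by norm_num), show (-1 - n) * (-1 - n + 1) = n * (n + 1) by ring]
    rcases Int.even_or_odd n with hn | hn <;> simp [hn.neg_one_zpow]
  simp only [Equiv.subLeft_apply, h', tsum_neg] at h
  linarith

theorem theta2Real_sq (hq0 : 0 < q) (hq1 : q < 1) :
    theta2Real (q ^ 2) ^ 2 = q * (∑' n : ℤ, (q ^ 2) ^ (n * (n + 1))) ^ 2 := by
  have hs := summable_pow_mul_succ (q := q ^ 2) (by positivity) (by nlinarith)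
  have h1 : ∑' n : ℤ, (q ^ 2) ^ (n * (n + 1)) = 2 * ∑' n : ℕ, (q ^ 2) ^ (n * (n + 1)) := by
    have e (n : ℕ) : (q ^ 2) ^ ((n : ℤ) * (n + 1)) = (q ^ 2) ^ (n * (n + 1)) := by
      exact_mod_cast rfl
    have e' (n : ℕ) : (q ^ 2) ^ (-((n : ℤ) + 1) * (-(n + 1) + 1)) = (q ^ 2) ^ (n * (n + 1)) := by
      rw [← e]
      ring_nf
    rw [tsum_of_nat_of_neg_add_one (hs.congr fun n => (e n).symm)
      (hs.congr fun n => (e' n).symm), tsum_congr e, tsum_congr e', two_mul]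
  have h2 (n : ℕ) : (q ^ 2) ^ (((n : ℝ) + 1 / 2) ^ 2) = √q * (q ^ 2) ^ (n * (n + 1)) := by
    rw [Real.sqrt_eq_rpow, ← pow_mul, ← Real.rpow_natCast q 2, ← Real.rpow_natCast q,
      ← Real.rpow_mul hq0.le, ← Real.rpow_add hq0]
    push_cast
    ring_nf
  rw [theta2Real, h1]
  simp only [h2, tsum_mul_left, mul_pow, Real.sq_sqrt hq0.le]
  ring

theorem theta3Real_sq (hq0 : 0 < q) (hq1 : q < 1) :
    theta3Real q ^ 2 = theta3Real (q ^ 2) ^ 2 + theta2Real (q ^ 2) ^ 2 := by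
  have hq0' : 0 < q ^ 2 := by positivity
  have hq1' : q ^ 2 < 1 := by nlinarith
  have h := summable_zpow_sq hq0 hq1
  have h' := summable_zpow_sq hq0' hq1'
  have h'' := summable_zpow_mul_succ hq0' hq1'
  rw [theta2Real_sq hq0 hq1, sq, theta3Real, theta3Real,
    tsum_mul_tsum_of_summable_norm h.norm h.norm,
    tsum_int_prod_eq_add_of_parity (summable_mul_of_summable_norm h.norm h.norm), sq (tsum _),
    sq (tsum _), tsum_mul_tsum_of_summable_norm h'.norm h'.norm,
    tsum_mul_tsum_of_summable_norm h''.norm h''.norm, ← tsum_mul_left]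
  congr 1 <;> refine tsum_congr fun z => ?_
  · simp only [← zpow_natCast q 2, ← zpow_mul, ← zpow_add₀ hq0.ne']
    push_cast
    ring_nf
  · simp only [← zpow_natCast q 2, ← zpow_mul, ← zpow_add₀ hq0.ne', ← zpow_one_add₀ hq0.ne']
    push_cast
    ring_nf

theorem theta4Real_sq (hq0 : 0 < q) (hq1 : q < 1) :
    theta4Real q ^ 2 = theta3Real (q ^ 2) ^ 2 - theta2Real (q ^ 2) ^ 2 := by
  have hq0' : 0 < q ^ 2 := by positivity
  have hq1' : q ^ 2 < 1 := by nlinarith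
  have h := summable_neg_one_zpow_mul_zpow_sq hq0 hq1
  have h' := summable_zpow_sq hq0' hq1'
  have h'' := summable_zpow_mul_succ hq0' hq1'
  rw [theta2Real_sq hq0 hq1, sq, theta3Real, theta4Real,
    tsum_mul_tsum_of_summable_norm h.norm h.norm,
    tsum_int_prod_eq_add_of_parity (summable_mul_of_summable_norm h.norm h.norm), sq (tsum _),
    sq (tsum _), tsum_mul_tsum_of_summable_norm h'.norm h'.norm,
    tsum_mul_tsum_of_summable_norm h''.norm h''.norm, ← tsum_mul_left, sub_eq_add_neg, ← tsum_neg]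
  congr 1 <;> refine tsum_congr fun ⟨a, b⟩ => ?_
  · have e : (-1 : ℝ) ^ (a + b) * (-1) ^ (a - b) = 1 := by
      rw [← zpow_add₀ (by norm_num), show a + b + (a - b) = 2 * a by ring]
      exact (even_two_mul a).neg_one_zpow
    rw [mul_mul_mul_comm, e, one_mul]
    simp only [← zpow_natCast q 2, ← zpow_mul, ← zpow_add₀ hq0.ne']
    push_cast
    ring_nf
  · have e : (-1 : ℝ) ^ (a + b + 1) * (-1) ^ (a - b) = -1 := by
      rw [← zpow_add₀ (by norm_num), show a + b + 1 + (a - b) = 2 * a + 1 by ring]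
      exact (odd_two_mul_add_one a).neg_one_zpow
    rw [mul_mul_mul_comm, e, neg_one_mul, neg_inj]
    simp only [← zpow_natCast q 2, ← zpow_mul, ← zpow_add₀ hq0.ne', ← zpow_one_add₀ hq0.ne']
    push_cast
    ring_nf

theorem theta3Real_mul_theta4Real (hq0 : 0 < q) (hq1 : q < 1) :
    theta3Real q * theta4Real q = theta4Real (q ^ 2) ^ 2 := by
  have hq0' : 0 < q ^ 2 := by positivity
  have hq1' : q ^ 2 < 1 := by nlinarith
  have h3 := summable_zpow_sq hq0 hq1
  have h4 := summable_neg_one_zpow_mul_zpow_sq hq0 hq1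
  have h' := summable_neg_one_zpow_mul_zpow_sq hq0' hq1'
  have h'' := summable_neg_one_zpow_mul_zpow_mul_succ hq0' hq1'
  have h0 : theta4Real (q ^ 2) ^ 2 = theta4Real (q ^ 2) ^ 2 +
      q * ((∑' n : ℤ, (-1) ^ n * (q ^ 2) ^ (n * (n + 1))) *
        ∑' n : ℤ, (-1) ^ n * (q ^ 2) ^ (n * (n + 1))) := by
    simp [tsum_neg_one_zpow_mul_zpow_mul_succ]
  have e (a b : ℤ) : (-1 : ℝ) ^ (a - b) = (-1) ^ a * (-1) ^ b := by
    rw [← zpow_add₀ (by norm_num), show a + b = a - b + 2 * b by ring,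
      zpow_add₀ (by norm_num), (even_two_mul b).neg_one_zpow, mul_one]
  rw [h0, sq (theta4Real _), theta3Real, theta4Real, theta4Real,
    tsum_mul_tsum_of_summable_norm h3.norm h4.norm,
    tsum_int_prod_eq_add_of_parity (summable_mul_of_summable_norm h3.norm h4.norm),
    tsum_mul_tsum_of_summable_norm h'.norm h'.norm,
    tsum_mul_tsum_of_summable_norm h''.norm h''.norm, ← tsum_mul_left]
  congr 1 <;> refine tsum_congr fun ⟨a, b⟩ => ?_
  · rw [e, mul_mul_mul_comm, mul_left_comm]
    congr 1
    simp only [← zpow_natCast q 2, ← zpow_mul, ← zpow_add₀ hq0.ne']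
    push_cast
    ring_nf
  · rw [e, mul_mul_mul_comm, mul_left_comm, mul_left_comm q]
    congr 1
    simp only [← zpow_natCast q 2, ← zpow_mul, ← zpow_add₀ hq0.ne', ← zpow_one_add₀ hq0.ne']
    push_cast
    ring_nf

theorem theta3Real_pos (hq0 : 0 < q) (hq1 : q < 1) : 0 < theta3Real q :=
  (summable_zpow_sq hq0 hq1).tsum_pos (fun _ => (zpow_pos hq0 _).le) 0 (zpow_pos hq0 _)

theorem tendsto_theta3Real_pow_two_pow (hq0 : 0 < q) (hq1 : q < 1) :
    Tendsto (fun n : ℕ => theta3Real (q ^ 2 ^ n)) atTop (𝓝 1) := by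
  have h : Tendsto (fun n : ℕ => ∑' k : ℤ, (q ^ 2 ^ n) ^ (k ^ 2)) atTop
      (𝓝 (∑' k : ℤ, if k = 0 then 1 else 0)) := by
    refine tendsto_tsum_of_dominated_convergence (summable_zpow_sq hq0 hq1) (fun k => ?_)
      (.of_forall fun n k => ?_)
    · split_ifs with hk
      · simp [hk]
      · lift k ^ 2 to ℕ using sq_nonneg k with m hm
        have hm0 : m ≠ 0 := by
          rintro rfl
          exact hk (pow_eq_zero_iff two_ne_zero |>.1 hm.symm)
        simp only [zpow_natCast]
        refine squeeze_zero (fun n => by positivity) (fun n => ?_)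
          (tendsto_pow_atTop_nhds_zero_of_lt_one hq0.le hq1)
        rw [← pow_mul]
        exact pow_le_pow_of_le_one hq0.le hq1.le
          ((Nat.lt_two_pow_self).le.trans (Nat.le_mul_of_pos_right _ (Nat.pos_of_ne_zero hm0)))
    · rw [Real.norm_of_nonneg (by positivity)]
      lift k ^ 2 to ℕ using sq_nonneg k with m hm
      simp only [zpow_natCast]
      exact pow_le_pow_left₀ (by positivity)
        (pow_le_of_le_one hq0.le hq1.le (by positivity)) m
  simpa [theta3Real] using h

theorem agmSeq_theta_div {c : ℝ} (hc : 0 ≤ c) (hq0 : 0 < q) (hq1 : q < 1) (n : ℕ) :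
    agmSeq (theta3Real q ^ 2 / c) (theta4Real q ^ 2 / c) n =
      (theta3Real (q ^ 2 ^ n) ^ 2 / c, theta4Real (q ^ 2 ^ n) ^ 2 / c) := by
  induction n with
  | zero => simp [agmSeq]
  | succ n ih =>
    have h0 : 0 < q ^ 2 ^ n := by positivity
    have h1 : q ^ 2 ^ n < 1 := pow_lt_one₀ hq0.le hq1 (by positivity)
    rw [agmSeq, ih, pow_succ 2 n, pow_mul]
    congr 1
    · simp only [theta3Real_sq h0 h1, theta4Real_sq h0 h1]
      ring
    · simp only
      rw [← theta3Real_mul_theta4Real h0 h1, div_mul_div_comm, ← mul_pow, ← sq c, ← div_pow,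
        Real.sqrt_sq_eq_abs, abs_div, abs_of_nonneg hc, theta3Real_mul_theta4Real h0 h1,
        abs_of_nonneg (sq_nonneg _)]

end

theorem agm_one_add_theta_ratio (q : ℝ) (hq0 : 0 < q) (hq1 : q < 1) :
    agm (1 + theta2Real q ^ 2 / theta3Real q ^ 2)
        (1 - theta2Real q ^ 2 / theta3Real q ^ 2) = 1 / theta3Real q ^ 2 := by
  obtain ⟨p, hp0, hp1, rfl⟩ : ∃ p : ℝ, 0 < p ∧ p < 1 ∧ p ^ 2 = q :=
    ⟨√q, Real.sqrt_pos.2 hq0, by rwa [Real.sqrt_lt' one_pos, one_pow], Real.sq_sqrt hq0.le⟩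
  have hc : theta3Real (p ^ 2) ^ 2 ≠ 0 := pow_ne_zero 2 (theta3Real_pos hq0 hq1).ne'
  have h3 : 1 + theta2Real (p ^ 2) ^ 2 / theta3Real (p ^ 2) ^ 2 =
      theta3Real p ^ 2 / theta3Real (p ^ 2) ^ 2 := by
    rw [theta3Real_sq hp0 hp1, add_div, div_self hc]
  have h4 : 1 - theta2Real (p ^ 2) ^ 2 / theta3Real (p ^ 2) ^ 2 =
      theta4Real p ^ 2 / theta3Real (p ^ 2) ^ 2 := by
    rw [theta4Real_sq hp0 hp1, sub_div, div_self hc]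
  rw [h3, h4, agm]
  simp only [agmSeq_theta_div (sq_nonneg _) hp0 hp1]
  refine Tendsto.limUnder_eq ?_
  simpa using ((tendsto_theta3Real_pow_two_pow hp0 hp1).pow 2).div_const _
end

section
/- For every real q with 0 < q < 1, K(θ₂(q)²/θ₃(q)²) = (π/2)·θ₃(q)², where K is the complete elliptic integral of the first kind and θ₂, θ₃ are Jacobi theta functions. -/
open Real

/-- The complete elliptic integral of the first kind. -/
noncomputable def ellipticK (x : ℝ) : ℝ :=
  ∫ φ in (0 : ℝ)..(π / 2), 1 / Real.sqrt (1 - x ^ 2 * Real.sin φ ^ 2)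

open Filter Topology

/-! ### The Landen transformation -/

lemma one_sub_sq_mul_sin_sq_pos {k : ℝ} (h0 : 0 ≤ k) (h1 : k < 1) (t : ℝ) :
    0 < 1 - k ^ 2 * sin t ^ 2 := by
  have h2 : k ^ 2 < 1 := by nlinarith
  nlinarith [sin_sq_le_one t, sq_nonneg (sin t), sq_nonneg k]

lemma continuous_ellipticK_integrand {k : ℝ} (h0 : 0 ≤ k) (h1 : k < 1) :
    Continuous fun t : ℝ => 1 / √(1 - k ^ 2 * sin t ^ 2) :=
  continuous_const.div (by fun_prop) fun t => (sqrt_pos.2 (one_sub_sq_mul_sin_sq_pos h0 h1 t)).ne'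

lemma integral_zero_pi_ellipticK {k : ℝ} (h0 : 0 ≤ k) (h1 : k < 1) :
    ∫ t in (0 : ℝ)..π, 1 / √(1 - k ^ 2 * sin t ^ 2) = 2 * ellipticK k := by
  have hc := continuous_ellipticK_integrand h0 h1
  have hr : ∫ t in (π / 2)..π, 1 / √(1 - k ^ 2 * sin t ^ 2) = ellipticK k := by
    have h := intervalIntegral.integral_comp_sub_left (a := 0) (b := π / 2)
      (fun t : ℝ => 1 / √(1 - k ^ 2 * sin t ^ 2)) π
    simp only [sin_pi_sub, sub_zero] at h
    rw [ellipticK, h]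
    congr 1
    ring
  rw [← intervalIntegral.integral_add_adjacent_intervals (hc.intervalIntegrable 0 (π / 2))
    (hc.intervalIntegrable (π / 2) π), hr, ellipticK]
  ring

lemma sqrt_landen {k l : ℝ} (h0 : 0 ≤ k) (h1 : k < 1) (hl : l ^ 2 = 4 * k / (1 + k) ^ 2) (t : ℝ) :
    0 < √(1 - k ^ 2 * sin t ^ 2) + k * cos t ∧
    √(1 - l ^ 2 * sin ((t + arcsin (k * sin t)) / 2) ^ 2) =
      (√(1 - k ^ 2 * sin t ^ 2) + k * cos t) / (1 + k) := by
  have hp := one_sub_sq_mul_sin_sq_pos h0 h1 t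
  have hD := sq_sqrt hp.le
  have hD0 := sqrt_pos.2 hp
  have hcos : cos (arcsin (k * sin t)) = √(1 - k ^ 2 * sin t ^ 2) := by
    rw [cos_arcsin, mul_pow]
  have hsin : sin (arcsin (k * sin t)) = k * sin t :=
    sin_arcsin (by nlinarith [neg_one_le_sin t, sin_le_one t])
      (by nlinarith [neg_one_le_sin t, sin_le_one t])
  set D := √(1 - k ^ 2 * sin t ^ 2)
  have hsc := sin_sq_add_cos_sq t
  have hpos : 0 < D + k * cos t := by
    have : |k * cos t| < D := by
      apply abs_lt_of_sq_lt_sq _ hD0.le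
      rw [hD, mul_pow]
      nlinarith
    linarith [neg_abs_le (k * cos t)]
  refine ⟨hpos, ?_⟩
  have h2 : cos (t + arcsin (k * sin t)) = cos t * D - k * sin t ^ 2 := by
    rw [cos_add, hcos, hsin]; ring
  have hh : sin ((t + arcsin (k * sin t)) / 2) ^ 2 = (1 - (cos t * D - k * sin t ^ 2)) / 2 := by
    rw [sin_sq_eq_half_sub, mul_div_cancel₀ _ two_ne_zero, h2]; ring
  rw [sqrt_eq_iff_mul_self_eq_of_pos (by positivity), hh, hl]
  field_simp
  rw [sin_sq] at hD ⊢
  linear_combination 2 * hD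

/-- The ascending Landen transformation. -/
lemma ellipticK_landen {k l : ℝ} (h0 : 0 ≤ k) (h1 : k < 1) (hl0 : 0 ≤ l) (hl1 : l < 1)
    (hl : l ^ 2 = 4 * k / (1 + k) ^ 2) : ellipticK l = (1 + k) * ellipticK k := by
  have hderiv (t : ℝ) : HasDerivAt (fun t : ℝ => (t + arcsin (k * sin t)) / 2)
      ((1 + 1 / √(1 - k ^ 2 * sin t ^ 2) * (k * cos t)) / 2) t := by
    have ha := hasDerivAt_arcsin (x := k * sin t) (by nlinarith [neg_one_le_sin t, sin_le_one t])
      (by nlinarith [neg_one_le_sin t, sin_le_one t])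
    rw [mul_pow] at ha
    exact ((hasDerivAt_id t).add (ha.comp t ((hasDerivAt_sin t).const_mul k))).div_const 2
  have hc := continuous_ellipticK_integrand h0 h1
  have hs := intervalIntegral.integral_comp_mul_deriv (a := 0) (b := π)
    (fun t _ => hderiv t) (by fun_prop) (continuous_ellipticK_integrand hl0 hl1)
  simp only [sin_zero, sin_pi, mul_zero, arcsin_zero, add_zero, zero_div] at hs
  rw [ellipticK, ← hs, ← mul_right_inj' (two_ne_zero (α := ℝ)), mul_left_comm,
    ← integral_zero_pi_ellipticK h0 h1, ← intervalIntegral.integral_const_mul,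
    ← intervalIntegral.integral_const_mul]
  congr 1
  ext t
  obtain ⟨hpos, he⟩ := sqrt_landen h0 h1 hl t
  have hD0 := sqrt_pos.2 (one_sub_sq_mul_sin_sq_pos h0 h1 t)
  simp only [Function.comp_apply, he]
  field_simp

lemma tendsto_ellipticK_zero {ι : Type*} {F : Filter ι} {k : ι → ℝ} (h0 : ∀ i, 0 ≤ k i)
    (h1 : ∀ i, k i < 1) (hk : Tendsto k F (𝓝 0)) :
    Tendsto (fun i => ellipticK (k i)) F (𝓝 (π / 2)) := by
  have hup : Tendsto (fun i => π / 2 * (1 / √(1 - k i ^ 2))) F (𝓝 (π / 2)) := by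
    have hc : ContinuousAt (fun x : ℝ => π / 2 * (1 / √(1 - x ^ 2))) 0 := by
      refine continuousAt_const.mul (continuousAt_const.div (by fun_prop) (by simp))
    simpa [Function.comp_def] using hc.tendsto.comp hk
  refine tendsto_of_tendsto_of_tendsto_of_le_of_le tendsto_const_nhds hup (fun i => ?_) fun i => ?_
  · have := intervalIntegral.integral_mono_on (a := 0) (b := π / 2) (μ := MeasureTheory.volume)
      (f := fun _ => (1 : ℝ)) pi_div_two_pos.le
      intervalIntegrable_const ((continuous_ellipticK_integrand (h0 i) (h1 i)).intervalIntegrable _ _)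
      fun t _ => by
        have hp := one_sub_sq_mul_sin_sq_pos (h0 i) (h1 i) t
        rw [le_div_iff₀ (sqrt_pos.2 hp), one_mul, sqrt_le_one]
        nlinarith [mul_nonneg (sq_nonneg (k i)) (sq_nonneg (sin t))]
    simpa [ellipticK] using this
  · have := intervalIntegral.integral_mono_on (a := 0) (b := π / 2) (μ := MeasureTheory.volume)
      (g := fun _ => 1 / √(1 - k i ^ 2)) pi_div_two_pos.le
      ((continuous_ellipticK_integrand (h0 i) (h1 i)).intervalIntegrable _ _) intervalIntegrable_const
      fun t _ => by
        have hp : 0 < 1 - k i ^ 2 := by nlinarith [h0 i, h1 i]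
        have := sqrt_pos.2 hp
        gcongr
        nlinarith [sq_nonneg (k i), sin_sq_le_one t]
    simpa [ellipticK] using this

/-! ### Shifted theta series -/

/-- The theta series `∑ q ^ (n + c)²` over the integers, with characteristic `c`. -/
noncomputable def thetaShift (c q : ℝ) : ℝ := ∑' n : ℤ, q ^ (((n : ℝ) + c) ^ 2)

lemma summable_thetaShift (c : ℝ) {q : ℝ} (hq0 : 0 < q) (hq1 : q < 1) :
    Summable fun n : ℤ => q ^ (((n : ℝ) + c) ^ 2) := by
  have hg := summable_geometric_of_lt_one hq0.le hq1
  have hs : Summable fun n : ℤ => q ^ n.natAbs := by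
    apply Summable.of_nat_of_neg <;> simpa using hg
  refine Summable.of_nonneg_of_le (fun n => by positivity) (fun n => ?_)
    (hs.mul_left (q ^ (-|c| - 1 / 4)))
  rw [← rpow_natCast q, ← rpow_add hq0]
  apply rpow_le_rpow_of_exponent_ge hq0 hq1.le
  have h1 : ((n.natAbs : ℕ) : ℝ) = |(n : ℝ)| := by
    rw [Nat.cast_natAbs, Int.cast_abs]
  rw [h1]
  have h2 : |(n : ℝ)| ≤ |(n : ℝ) + c| + |c| := by
    simpa using abs_sub ((n : ℝ) + c) c
  nlinarith [sq_abs ((n : ℝ) + c), sq_nonneg (|(n : ℝ) + c| - 1 / 2)]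

/-- Pairs of integers, split according to the parity of their sum. -/
def paritySplit : (ℤ × ℤ) ⊕ (ℤ × ℤ) ≃ ℤ × ℤ where
  toFun := Sum.elim (fun p => (p.1 + p.2, p.1 - p.2)) fun p => (p.1 + p.2 + 1, p.1 - p.2)
  invFun p := if (p.1 + p.2) % 2 = 0 then .inl ((p.1 + p.2) / 2, (p.1 - p.2) / 2)
    else .inr ((p.1 + p.2) / 2, (p.1 - p.2) / 2)
  left_inv := by
    rintro (⟨a, b⟩ | ⟨a, b⟩)
    · have h : (a + b + (a - b)) % 2 = 0 := by omega
      simp only [Sum.elim_inl, h, if_true, Sum.inl.injEq, Prod.mk.injEq]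
      omega
    · have h : ¬ (a + b + 1 + (a - b)) % 2 = 0 := by omega
      simp only [Sum.elim_inr, h, if_false, Sum.inr.injEq, Prod.mk.injEq]
      omega
  right_inv := by
    rintro ⟨m, n⟩
    dsimp only
    split_ifs with h
    · simp only [Sum.elim_inl, Prod.mk.injEq]
      omega
    · simp only [Sum.elim_inr, Prod.mk.injEq]
      omega

lemma hasSum_thetaShift_mul (c d : ℝ) {q : ℝ} (hq0 : 0 < q) (hq1 : q < 1) :
    HasSum (fun p : ℤ × ℤ => q ^ (((p.1 : ℝ) + c) ^ 2 + ((p.2 : ℝ) + d) ^ 2))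
      (thetaShift c q * thetaShift d q) := by
  have hc := summable_thetaShift c hq0 hq1
  have hd := summable_thetaShift d hq0 hq1
  have h := hc.hasSum.mul hd.hasSum (hc.mul_of_nonneg hd (fun _ => by positivity)
    fun _ => by positivity)
  simpa only [← rpow_add hq0, thetaShift] using h

lemma thetaShift_sq (c : ℝ) {q : ℝ} (hq0 : 0 < q) (hq1 : q < 1) :
    thetaShift c q ^ 2 = thetaShift c (q ^ 2) * thetaShift 0 (q ^ 2) +
      thetaShift (c + 1 / 2) (q ^ 2) * thetaShift (1 / 2) (q ^ 2) := by
  have hr0 : 0 < q ^ 2 := by positivity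
  have hr1 : q ^ 2 < 1 := by nlinarith
  have hsq (x : ℝ) : (q ^ 2) ^ x = q ^ (2 * x) := by
    rw [rpow_mul hq0.le, rpow_two]
  have h1 := hasSum_thetaShift_mul c 0 hr0 hr1
  have h2 := hasSum_thetaShift_mul (c + 1 / 2) (1 / 2) hr0 hr1
  have h := hasSum_thetaShift_mul c c hq0 hq1
  rw [← paritySplit.hasSum_iff] at h
  rw [sq]
  refine h.unique (HasSum.sum ?_ ?_)
  · convert h1 using 2 with p
    simp only [paritySplit, Equiv.coe_fn_mk, Function.comp_apply, Sum.elim_inl, hsq]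
    push_cast
    ring_nf
  · convert h2 using 2 with p
    simp only [paritySplit, Equiv.coe_fn_mk, Function.comp_apply, Sum.elim_inr, hsq]
    push_cast
    ring_nf

lemma thetaShift_one (q : ℝ) : thetaShift 1 q = thetaShift 0 q := by
  rw [thetaShift, thetaShift, ← (Equiv.addRight (1 : ℤ)).tsum_eq fun n : ℤ => q ^ (((n : ℝ) + 0) ^ 2)]
  simp

lemma thetaShift_pos (c : ℝ) {q : ℝ} (hq0 : 0 < q) (hq1 : q < 1) : 0 < thetaShift c q :=
  (summable_thetaShift c hq0 hq1).tsum_pos (fun _ => by positivity) 0 (by positivity)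

lemma theta3Real_eq (q : ℝ) : theta3Real q = thetaShift 0 q := by
  rw [theta3Real, thetaShift]
  congr 1
  ext n
  rw [add_zero, ← rpow_intCast]
  push_cast
  rfl

lemma theta2Real_eq {q : ℝ} (hq0 : 0 < q) (hq1 : q < 1) :
    theta2Real q = thetaShift (1 / 2) q := by
  have hs := summable_thetaShift (1 / 2) hq0 hq1
  have hneg (n : ℕ) : q ^ ((((-((n : ℤ) + 1) : ℤ) : ℝ) + 1 / 2) ^ 2) =
      q ^ (((n : ℝ) + 1 / 2) ^ 2) := by
    push_cast
    ring_nf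
  have hn : Summable fun n : ℕ => q ^ (((n : ℝ) + 1 / 2) ^ 2) := by
    simpa [Function.comp_def] using hs.comp_injective Nat.cast_injective
  rw [theta2Real, thetaShift, tsum_of_nat_of_neg_add_one (by simpa using hn)
    (by simpa only [hneg] using hn)]
  simp only [hneg, Int.cast_natCast]
  ring

lemma tendsto_thetaShift (c : ℝ) {q : ℝ} (hq0 : 0 < q) (hq1 : q < 1) :
    Tendsto (fun n : ℕ => thetaShift c (q ^ 2 ^ n)) atTop (𝓝 (thetaShift c 0)) := by
  have hx : Tendsto (fun n : ℕ => q ^ 2 ^ n) atTop (𝓝 0) :=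
    (tendsto_pow_atTop_nhds_zero_of_lt_one hq0.le hq1).comp
      (tendsto_pow_atTop_atTop_of_one_lt one_lt_two)
  refine tendsto_tsum_of_dominated_convergence (summable_thetaShift c hq0 hq1) (fun n => ?_)
    (.of_forall fun k n => ?_)
  · exact ((continuousAt_rpow_const 0 _ (Or.inr (sq_nonneg _))).tendsto).comp hx
  · rw [norm_of_nonneg (by positivity)]
    exact rpow_le_rpow (by positivity)
      (pow_le_of_le_one hq0.le hq1.le (by positivity)) (sq_nonneg _)

lemma thetaShift_zero_zero : thetaShift 0 0 = 1 := by
  rw [thetaShift, tsum_eq_single 0]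
  · simp
  · intro n hn
    exact zero_rpow (by simpa using hn)

lemma thetaShift_half_zero : thetaShift (1 / 2) 0 = 0 := by
  rw [thetaShift]
  convert tsum_zero with n
  refine zero_rpow (pow_ne_zero 2 fun h => ?_)
  have h2 : ((2 * n + 1 : ℤ) : ℝ) = 0 := by
    push_cast
    linarith
  have h3 : 2 * n + 1 = 0 := by exact_mod_cast h2
  omega

lemma thetaShift_zero_sq {q : ℝ} (hq0 : 0 < q) (hq1 : q < 1) :
    thetaShift 0 q ^ 2 = thetaShift 0 (q ^ 2) ^ 2 + thetaShift (1 / 2) (q ^ 2) ^ 2 := by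
  rw [thetaShift_sq 0 hq0 hq1, zero_add]
  ring

lemma thetaShift_half_sq {q : ℝ} (hq0 : 0 < q) (hq1 : q < 1) :
    thetaShift (1 / 2) q ^ 2 = 2 * (thetaShift 0 (q ^ 2) * thetaShift (1 / 2) (q ^ 2)) := by
  rw [thetaShift_sq _ hq0 hq1, add_halves, thetaShift_one]
  ring

lemma pow_two_pow_mem {q : ℝ} (hq0 : 0 < q) (hq1 : q < 1) (n : ℕ) :
    0 < q ^ 2 ^ n ∧ q ^ 2 ^ n < 1 :=
  ⟨by positivity, pow_lt_one₀ hq0.le hq1 (by positivity)⟩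

lemma thetaShift_half_ne {q : ℝ} (hq0 : 0 < q) (hq1 : q < 1) :
    thetaShift (1 / 2) q ≠ thetaShift 0 q := by
  intro h
  have hall (n : ℕ) : thetaShift (1 / 2) (q ^ 2 ^ n) = thetaShift 0 (q ^ 2 ^ n) := by
    induction n with
    | zero => simpa using h
    | succ n ih =>
      obtain ⟨h0, h1⟩ := pow_two_pow_mem hq0 hq1 n
      have hz := thetaShift_zero_sq h0 h1
      have hh := thetaShift_half_sq h0 h1
      rw [ih] at hh
      rw [pow_succ, pow_mul]
      have : (thetaShift (1 / 2) ((q ^ 2 ^ n) ^ 2) - thetaShift 0 ((q ^ 2 ^ n) ^ 2)) ^ 2 = 0 := by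
        linear_combination hh - hz
      exact sub_eq_zero.1 (pow_eq_zero_iff two_ne_zero |>.1 this)
  have := tendsto_nhds_unique (tendsto_thetaShift (1 / 2) hq0 hq1)
    ((tendsto_thetaShift 0 hq0 hq1).congr fun n => (hall n).symm)
  rw [thetaShift_half_zero, thetaShift_zero_zero] at this
  exact zero_ne_one this

/-- The elliptic modulus as a function of the nome. -/
noncomputable def thetaModulus (q : ℝ) : ℝ := thetaShift (1 / 2) q ^ 2 / thetaShift 0 q ^ 2

lemma thetaModulus_nonneg (q : ℝ) : 0 ≤ thetaModulus q := by
  unfold thetaModulus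
  positivity

lemma thetaModulus_lt_one {q : ℝ} (hq0 : 0 < q) (hq1 : q < 1) : thetaModulus q < 1 := by
  have hp := thetaShift_pos 0 hq0 hq1
  have hr0 : 0 < q ^ 2 := by positivity
  have hr1 : q ^ 2 < 1 := by nlinarith
  rw [thetaModulus, div_lt_one (by positivity), thetaShift_zero_sq hq0 hq1,
    thetaShift_half_sq hq0 hq1]
  nlinarith [sq_pos_of_ne_zero (sub_ne_zero.2 (thetaShift_half_ne hr0 hr1))]

lemma ellipticK_thetaModulus_sq {q : ℝ} (hq0 : 0 < q) (hq1 : q < 1) :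
    ellipticK (thetaModulus q) / thetaShift 0 q ^ 2 =
      ellipticK (thetaModulus (q ^ 2)) / thetaShift 0 (q ^ 2) ^ 2 := by
  have hr0 : 0 < q ^ 2 := by positivity
  have hr1 : q ^ 2 < 1 := by nlinarith
  have hp := thetaShift_pos 0 hr0 hr1
  rw [ellipticK_landen (thetaModulus_nonneg _) (thetaModulus_lt_one hr0 hr1)
    (thetaModulus_nonneg _) (thetaModulus_lt_one hq0 hq1)]
  · rw [thetaShift_zero_sq hq0 hq1]
    nth_rewrite 1 [thetaModulus]
    field_simp
  · rw [thetaModulus, thetaModulus, thetaShift_zero_sq hq0 hq1, thetaShift_half_sq hq0 hq1]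
    field_simp
    ring

theorem ellipticK_theta (q : ℝ) (hq0 : 0 < q) (hq1 : q < 1) :
    ellipticK (theta2Real q ^ 2 / theta3Real q ^ 2) = (π / 2) * theta3Real q ^ 2 := by
  rw [theta3Real_eq, theta2Real_eq hq0 hq1, ← thetaModulus]
  have hp := thetaShift_pos 0 hq0 hq1
  rw [← div_eq_iff (by positivity)]
  have hconst (n : ℕ) : ellipticK (thetaModulus (q ^ 2 ^ n)) / thetaShift 0 (q ^ 2 ^ n) ^ 2 =
      ellipticK (thetaModulus q) / thetaShift 0 q ^ 2 := by
    induction n with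
    | zero => simp
    | succ n ih =>
      obtain ⟨h0, h1⟩ := pow_two_pow_mem hq0 hq1 n
      rw [← ih, ellipticK_thetaModulus_sq h0 h1, pow_succ, pow_mul]
  have h3 := (tendsto_thetaShift 0 hq0 hq1).pow 2
  have h2 := (tendsto_thetaShift (1 / 2) hq0 hq1).pow 2
  rw [thetaShift_zero_zero] at h3
  rw [thetaShift_half_zero] at h2
  have hk : Tendsto (fun n : ℕ => thetaModulus (q ^ 2 ^ n)) atTop (𝓝 0) := by
    have h := h2.div h3 (by norm_num)
    rwa [zero_pow two_ne_zero, zero_div] at h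
  have hK := tendsto_ellipticK_zero (fun n => thetaModulus_nonneg (q ^ 2 ^ n))
    (fun n => thetaModulus_lt_one (pow_two_pow_mem hq0 hq1 n).1 (pow_two_pow_mem hq0 hq1 n).2) hk
  have hlim := hK.div h3 (by norm_num)
  rw [one_pow, div_one] at hlim
  exact tendsto_nhds_unique (tendsto_const_nhds.congr fun n => (hconst n).symm) hlim
end

section
/- (André) For every real s with |s| < π/2, tan s = Σ_{n odd, n ≥ 1} T_n · sⁿ/n!, where T_n is the number of alternating permutations of {0,…,n−1}; in particular the series on the right converges for |s| < π/2. -/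
open Real

/-- A permutation `σ` of `{0, 1, …, m−1}` is alternating if `σ 0 < σ 1 > σ 2 < σ 3 > …`,
i.e. `σ i < σ (i+1)` for even `i` and `σ i > σ (i+1)` for odd `i`. -/
def IsAlternating {m : ℕ} (σ : Equiv.Perm (Fin m)) : Prop :=
  ∀ (i : ℕ) (h : i + 1 < m),
    (Even i → σ ⟨i, Nat.lt_of_succ_lt h⟩ < σ ⟨i + 1, h⟩) ∧
    (¬ Even i → σ ⟨i + 1, h⟩ < σ ⟨i, Nat.lt_of_succ_lt h⟩)

/-- `altCount m` is the number of alternating permutations of `{0, 1, …, m−1}`. -/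
noncomputable def altCount (m : ℕ) : ℕ :=
  Nat.card {σ : Equiv.Perm (Fin m) // IsAlternating σ}

/-- A list `a₀, a₁, a₂, …` is alternating if `a₀ < a₁ > a₂ < ⋯`. -/
def IsAlternatingList {α : Type*} [LinearOrder α] (l : List α) : Prop :=
  ∀ (i : ℕ) (h : i + 1 < l.length),
    (Even i → l[i] < l[i + 1]) ∧ (¬ Even i → l[i + 1] < l[i])

open Classical in
/-- The finite set of alternating arrangements of the elements of `S`. -/
noncomputable def alternatingArrangements {α : Type*} [LinearOrder α] (S : Finset α) :
    Finset (List α) :=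
  {l ∈ S.val.lists.toFinset | IsAlternatingList l}

theorem mem_alternatingArrangements {α : Type*} [LinearOrder α] {S : Finset α} {l : List α} :
    l ∈ alternatingArrangements S ↔
      l.Nodup ∧ (∀ x, x ∈ l ↔ x ∈ S) ∧ IsAlternatingList l := by
  classical
  unfold alternatingArrangements
  rw [Finset.mem_filter, Multiset.mem_toFinset, Multiset.mem_lists_iff, ← and_assoc]
  refine and_congr_left fun _ => ⟨fun h => ?_, fun ⟨h₁, h₂⟩ => ?_⟩
  · have h' : S.val = (l : Multiset α) := h
    refine ⟨Multiset.coe_nodup.1 (h' ▸ S.nodup), fun x => ?_⟩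
    rw [← Finset.mem_val, h', Multiset.mem_coe]
  · refine (Multiset.Nodup.ext S.nodup (Multiset.coe_nodup.2 h₁)).2 fun x => ?_
    rw [Finset.mem_val, Multiset.mem_coe, h₂]

theorem length_eq_card_of_forall_mem_iff {α : Type*} [DecidableEq α] {S : Finset α} {l : List α}
    (hl : l.Nodup) (h : ∀ x, x ∈ l ↔ x ∈ S) : l.length = S.card := by
  rw [← List.toFinset_card_of_nodup hl]
  congr 1
  ext x
  simp [h]

theorem card_alternatingArrangements {α : Type*} [LinearOrder α] (S : Finset α) :
    (alternatingArrangements S).card = altCount S.card := by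
  have e := S.orderIsoOfFin rfl
  rw [altCount, ← Nat.card_eq_finsetCard]
  symm
  have mem : ∀ σ : {σ : Equiv.Perm (Fin S.card) // IsAlternating σ},
      List.ofFn (fun i => (e (σ.1 i) : α)) ∈ alternatingArrangements S := by
    rintro ⟨σ, hσ⟩
    refine mem_alternatingArrangements.2 ⟨?_, fun x => ?_, fun i h => ?_⟩
    · rw [List.nodup_ofFn]
      exact Subtype.val_injective.comp (e.injective.comp σ.injective)
    · rw [List.mem_ofFn]
      constructor
      · rintro ⟨i, rfl⟩
        exact (e (σ i)).2
      · intro hx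
        exact ⟨σ.symm (e.symm ⟨x, hx⟩), by simp⟩
    · have h' : i + 1 < S.card := by simpa using h
      simpa using hσ i h'
  refine Nat.card_congr (Equiv.ofBijective (fun σ => ⟨_, mem σ⟩) ⟨?_, ?_⟩)
  · intro σ τ h
    have h := List.ofFn_injective (congrArg Subtype.val h)
    ext i
    have := congrFun h i
    simpa [Fin.val_inj] using this
  · rintro ⟨l, hl⟩
    obtain ⟨hn, hm, ha⟩ := mem_alternatingArrangements.1 hl
    have hlen := length_eq_card_of_forall_mem_iff hn hm
    let f : Fin S.card → Fin S.card := fun i =>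
      e.symm ⟨l[i.1]'(i.2.trans_eq hlen.symm), (hm _).1 (List.getElem_mem _)⟩
    have hf : Function.Injective f := by
      intro i j hij
      have := Subtype.ext_iff.1 (e.symm.injective hij)
      exact Fin.ext ((hn.getElem_inj_iff).1 this)
    refine ⟨⟨Equiv.ofBijective f (Finite.injective_iff_bijective.1 hf), fun i h => ?_⟩, ?_⟩
    · simpa [f] using ha i (by rw [hlen]; exact h)
    · refine Subtype.ext (List.ext_getElem (by simp [hlen]) fun i h₁ h₂ => ?_)
      simp [f]

theorem isAlternatingList_append_cons_iff {α : Type*} [LinearOrder α] {l₁ l₂ : List α} {M : α}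
    (h₁ : ∀ x ∈ l₁, x < M) (h₂ : ∀ x ∈ l₂, x < M) (h : 0 < l₁.length + l₂.length) :
    IsAlternatingList (l₁ ++ M :: l₂) ↔
      Odd l₁.length ∧ IsAlternatingList l₁ ∧ IsAlternatingList l₂ := by
  have left : ∀ (i : ℕ) (hi : i < l₁.length),
      (l₁ ++ M :: l₂)[i]'(by simp; omega) = l₁[i] := fun i hi => List.getElem_append_left hi
  have mid : (l₁ ++ M :: l₂)[l₁.length]'(by simp) = M := by simp
  have right : ∀ (i : ℕ) (hi : i < l₂.length),
      (l₁ ++ M :: l₂)[l₁.length + 1 + i]'(by simp; omega) = l₂[i] := by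
    intro i hi
    rw [List.getElem_append_right (by omega)]
    simp [Nat.add_assoc, Nat.add_comm 1 i]
  constructor
  · intro H
    have hodd : Odd l₁.length := by
      by_contra hev
      rw [Nat.not_odd_iff_even] at hev
      rcases Nat.eq_zero_or_pos l₂.length with h0 | hpos
      · obtain ⟨k, hk⟩ : ∃ k, l₁.length = k + 1 := ⟨l₁.length - 1, by omega⟩
        have := (H k (by simp; omega)).2 (by rw [hk] at hev; grind)
        rw [left k (by omega)] at this
        simp only [← hk, mid] at this
        exact lt_asymm this (h₁ _ (List.getElem_mem _))
      · have := (H l₁.length (by simp; omega)).1 hev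
        rw [mid] at this
        have r := right 0 hpos
        simp only [Nat.add_zero] at r
        rw [r] at this
        exact lt_asymm this (h₂ _ (List.getElem_mem _))
    refine ⟨hodd, fun i hi => ?_, fun i hi => ?_⟩
    · have := H i (by simp; omega)
      rwa [left i (by omega), left (i + 1) hi] at this
    · have := H (l₁.length + 1 + i) (by simp; omega)
      have r := right (i + 1) hi
      simp only [← Nat.add_assoc] at r
      rw [right i (by omega), r] at this
      have hp : Even (l₁.length + 1 + i) ↔ Even i := by grind
      rwa [hp] at this
  · rintro ⟨hodd, H₁, H₂⟩ i hi
    have hi' : i < l₁.length + l₂.length := by simp at hi; omega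
    rcases lt_trichotomy (i + 1) l₁.length with hlt | heq | hgt
    · rw [left i (by omega), left (i + 1) hlt]
      exact H₁ i hlt
    · rw [left i (by omega)]
      simp only [heq, mid]
      exact ⟨fun _ => h₁ _ (List.getElem_mem _), fun hne => absurd hodd (by rw [← heq]; grind)⟩
    · rcases Nat.eq_or_lt_of_le (Nat.lt_succ_iff.1 hgt) with heq | hlt
      · have r := right 0 (by omega)
        simp only [Nat.add_zero] at r
        subst heq
        rw [mid, r]
        exact ⟨fun hev => absurd hodd (by grind), fun _ => h₂ _ (List.getElem_mem _)⟩
      · obtain ⟨j, rfl⟩ : ∃ j, i = l₁.length + 1 + j := ⟨i - (l₁.length + 1), by omega⟩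
        have r := right (j + 1) (by omega)
        simp only [← Nat.add_assoc] at r
        rw [right j (by omega), r]
        have hp : Even (l₁.length + 1 + j) ↔ Even j := by grind
        rw [hp]
        exact H₂ j (by omega)

theorem card_alternatingArrangements_insert {α : Type*} [LinearOrder α] {U : Finset α} {M : α}
    (hU : U.Nonempty) (hM : ∀ x ∈ U, x < M) :
    (alternatingArrangements (insert M U)).card =
      ∑ A ∈ U.powerset with Odd A.card,
        (alternatingArrangements A).card * (alternatingArrangements (U \ A)).card := by
  have hMU : M ∉ U := fun h => lt_irrefl _ (hM M h)
  simp_rw [← Finset.card_product]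
  rw [← Finset.card_sigma]
  symm
  refine Finset.card_bij (fun p _ => p.2.1 ++ M :: p.2.2) ?_ ?_ ?_
  · rintro ⟨A, l₁, l₂⟩ hp
    simp only [Finset.mem_sigma, Finset.mem_filter, Finset.mem_powerset, Finset.mem_product,
      mem_alternatingArrangements, Finset.mem_sdiff] at hp
    obtain ⟨⟨hA, hodd⟩, ⟨n₁, m₁, a₁⟩, n₂, m₂, a₂⟩ := hp
    have hlen := length_eq_card_of_forall_mem_iff n₁ m₁
    refine mem_alternatingArrangements.2 ⟨?_, fun x => ?_, ?_⟩
    · rw [List.nodup_append]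
      refine ⟨n₁, List.nodup_cons.2 ⟨by grind, n₂⟩, by grind⟩
    · simp only [List.mem_append, List.mem_cons, m₁, m₂, Finset.mem_insert]
      have := @hA x
      tauto
    · rw [isAlternatingList_append_cons_iff (by grind) (by grind)
        (by rw [hlen]; have := hodd.pos; omega)]
      exact ⟨hlen ▸ hodd, a₁, a₂⟩
  · rintro ⟨A, l₁, l₂⟩ hp ⟨B, k₁, k₂⟩ hq heq
    simp only [Finset.mem_sigma, Finset.mem_filter, Finset.mem_powerset, Finset.mem_product,
      mem_alternatingArrangements, Finset.mem_sdiff] at hp hq heq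
    obtain ⟨⟨hA, -⟩, ⟨-, m₁, -⟩, -, m₂, -⟩ := hp
    obtain ⟨⟨hB, -⟩, ⟨-, m₁', -⟩, -, m₂', -⟩ := hq
    obtain ⟨rfl, -, rfl⟩ := (List.append_cons_inj_of_notMem (by grind) (by grind)).1 heq
    obtain rfl : A = B := by
      ext x
      rw [← m₁, m₁']
    rfl
  · intro l hl
    obtain ⟨hn, hm, ha⟩ := mem_alternatingArrangements.1 hl
    obtain ⟨l₁, l₂, rfl⟩ := List.append_of_mem ((hm M).2 (Finset.mem_insert_self M U))
    rw [List.nodup_append, List.nodup_cons] at hn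
    obtain ⟨n₁, ⟨hM₂, n₂⟩, hd⟩ := hn
    simp only [List.mem_append, List.mem_cons, Finset.mem_insert] at hm hd
    have hM₁ : M ∉ l₁ := by grind
    have s₁ : ∀ x ∈ l₁, x ∈ U := fun x hx =>
      ((hm x).1 (Or.inl hx)).resolve_left (by rintro rfl; exact hM₁ hx)
    have s₂ : ∀ x ∈ l₂, x ∈ U := fun x hx =>
      ((hm x).1 (Or.inr (Or.inr hx))).resolve_left (by rintro rfl; exact hM₂ hx)
    have hpos : 0 < l₁.length + l₂.length := by
      obtain ⟨x, hx⟩ := hU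
      have hxM : x ≠ M := (hM x hx).ne
      rcases (hm x).2 (Or.inr hx) with h | h | h
      · have := List.length_pos_of_mem h
        omega
      · exact absurd h hxM
      · have := List.length_pos_of_mem h
        omega
    rw [isAlternatingList_append_cons_iff (fun x hx => hM x (s₁ x hx))
      (fun x hx => hM x (s₂ x hx)) hpos] at ha
    refine ⟨⟨l₁.toFinset, l₁, l₂⟩, ?_, rfl⟩
    simp only [Finset.mem_sigma, Finset.mem_filter, Finset.mem_powerset, Finset.mem_product,
      mem_alternatingArrangements, Finset.mem_sdiff, List.mem_toFinset,
      List.toFinset_card_of_nodup n₁]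
    refine ⟨⟨fun x hx => s₁ x (List.mem_toFinset.1 hx), ha.1⟩,
      ⟨n₁, fun _ => trivial, ha.2.1⟩, n₂, fun x => ⟨fun hx => ⟨s₂ x hx, fun hx' => ?_⟩, ?_⟩,
      ha.2.2⟩
    · exact hd x hx' x (Or.inr hx) rfl
    · rintro ⟨hx, hx'⟩
      rcases (hm x).2 (Or.inr hx) with h | h | h
      · exact absurd h hx'
      · exact absurd h (hM x hx).ne
      · exact h

/-- André's recurrence, obtained by splitting an alternating permutation at its maximum. -/
theorem altCount_succ {n : ℕ} (hn : 0 < n) :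
    altCount (n + 1) =
      ∑ k ∈ Finset.range (n + 1),
        n.choose k * if Odd k then altCount k * altCount (n - k) else 0 := by
  have h := card_alternatingArrangements_insert (U := Finset.range n) (M := n)
    (Finset.nonempty_range_iff.2 hn.ne') (fun x hx => Finset.mem_range.1 hx)
  rw [← Finset.range_add_one, card_alternatingArrangements, Finset.card_range] at h
  rw [h, Finset.sum_filter]
  have key := Finset.sum_powerset_apply_card
    (fun k => if Odd k then altCount k * altCount (n - k) else 0) (x := Finset.range n)
  simp only [Finset.card_range, smul_eq_mul] at key
  rw [← key]
  refine Finset.sum_congr rfl fun A hA => ?_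
  rw [card_alternatingArrangements, card_alternatingArrangements,
    Finset.card_sdiff_of_subset (Finset.mem_powerset.1 hA), Finset.card_range]

theorem altCount_one : altCount 1 = 1 := by
  rw [altCount, Nat.card_eq_one_iff_unique]
  exact ⟨inferInstance, ⟨1, fun i h => absurd h (by omega)⟩⟩

theorem Complex.cos_ne_zero_of_norm_lt {z : ℂ} (hz : ‖z‖ < π / 2) : Complex.cos z ≠ 0 := by
  rw [Ne, Complex.cos_eq_zero_iff]
  rintro ⟨k, rfl⟩
  have hk : (1 : ℝ) ≤ |2 * (k : ℝ) + 1| := by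
    have : (1 : ℤ) ≤ |2 * k + 1| := Int.one_le_abs (by omega)
    exact_mod_cast this
  have hnorm : ‖(2 * (k : ℂ) + 1) * (π : ℂ) / 2‖ = |2 * (k : ℝ) + 1| * (π / 2) := by
    rw [show (2 * (k : ℂ) + 1) * (π : ℂ) / 2 = (((2 * (k : ℝ) + 1) * (π / 2) : ℝ) : ℂ) by
      push_cast; ring, Complex.norm_real, Real.norm_eq_abs, abs_mul, abs_of_pos Real.pi_div_two_pos]
  rw [hnorm] at hz
  nlinarith [Real.pi_div_two_pos]

theorem Complex.iteratedDeriv_tan_zero_succ (n : ℕ) :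
    iteratedDeriv (n + 1) Complex.tan 0 = (if n = 0 then 1 else 0) +
      ∑ k ∈ Finset.range (n + 1),
        (n.choose k : ℂ) * iteratedDeriv k Complex.tan 0 * iteratedDeriv (n - k) Complex.tan 0 := by
  have hd : deriv Complex.tan =ᶠ[nhds 0]
      (fun _ => (1 : ℂ)) + (fun z => Complex.tan z * Complex.tan z) := by
    have hc : ∀ᶠ z : ℂ in nhds 0, Complex.cos z ≠ 0 :=
      Complex.continuous_cos.continuousAt.eventually_ne (by simp)
    filter_upwards [hc] with z hz
    rw [Complex.deriv_tan, Pi.add_apply, Complex.tan_eq_sin_div_cos]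
    field_simp
    rw [Complex.cos_sq_add_sin_sq]
  have ht : ContDiffAt ℂ n Complex.tan 0 := Complex.contDiffAt_tan.2 (by simp)
  rw [iteratedDeriv_succ', hd.iteratedDeriv_eq, iteratedDeriv_add contDiffAt_const (ht.mul ht),
    iteratedDeriv_const, iteratedDeriv_fun_mul ht ht]

theorem Complex.iteratedDeriv_tan_zero (n : ℕ) :
    iteratedDeriv n Complex.tan 0 = if Odd n then (altCount n : ℂ) else 0 := by
  induction n using Nat.strong_induction_on with
  | _ n ih =>
    rcases n with _ | _ | n
    · simp
    · rw [Complex.iteratedDeriv_tan_zero_succ]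
      simp [altCount_one]
    · rw [Complex.iteratedDeriv_tan_zero_succ, altCount_succ n.succ_pos, if_neg n.succ_ne_zero,
        zero_add]
      by_cases hodd : Odd (n + 1 + 1)
      · rw [if_pos hodd]
        push_cast
        refine Finset.sum_congr rfl fun k hk => ?_
        have hk' := Finset.mem_range.1 hk
        rw [ih k (by omega), ih (n + 1 - k) (by omega)]
        by_cases hk_odd : Odd k
        · have : Odd (n + 1 - k) := by grind
          simp [hk_odd, this, mul_assoc]
        · simp [hk_odd]
      · rw [if_neg hodd]
        refine Finset.sum_eq_zero fun k hk => ?_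
        have hk' := Finset.mem_range.1 hk
        rw [ih k (by omega), ih (n + 1 - k) (by omega)]
        by_cases hk_odd : Odd k
        · have : ¬ Odd (n + 1 - k) := by grind
          simp [this]
        · simp [hk_odd]

/-- André's theorem: the exponential generating function of the numbers of alternating
permutations of odd length is `tan`. -/
theorem andre_tan (s : ℝ) (hs : |s| < π / 2) :
    Summable (fun n : ℕ => if Odd n then (altCount n : ℝ) * s ^ n / n.factorial else 0) ∧
    Real.tan s =
      ∑' n : ℕ, if Odd n then (altCount n : ℝ) * s ^ n / n.factorial else 0 := by
  have hsum : HasSum (fun n : ℕ => if Odd n then (altCount n : ℝ) * s ^ n / n.factorial else 0)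
      (Real.tan s) := by
    have hball : DifferentiableOn ℂ Complex.tan (Metric.ball 0 (π / 2)) := fun z hz =>
      (Complex.differentiableAt_tan.2
        (Complex.cos_ne_zero_of_norm_lt (mem_ball_zero_iff.1 hz))).differentiableWithinAt
    have hmem : (s : ℂ) ∈ Metric.ball (0 : ℂ) (π / 2) := by
      rwa [mem_ball_zero_iff, Complex.norm_real, Real.norm_eq_abs]
    rw [← Complex.hasSum_ofReal, Complex.ofReal_tan]
    have hterm : ∀ n : ℕ,
        (n.factorial : ℂ)⁻¹ • ((s : ℂ) - 0) ^ n • iteratedDeriv n Complex.tan 0 =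
          ((if Odd n then (altCount n : ℝ) * s ^ n / n.factorial else 0 : ℝ) : ℂ) := by
      intro n
      rw [Complex.iteratedDeriv_tan_zero]
      split_ifs
      · simp only [smul_eq_mul, sub_zero]
        push_cast
        ring
      · simp
    simpa only [hterm] using Complex.hasSum_taylorSeries_on_ball hball hmem
  exact ⟨hsum.summable, hsum.tsum_eq.symm⟩
end
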